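/- arXiv:2508.12386 — 3 statements merged into one kernel-verified Lean document; each statement's English description precedes it below -/
import Mathlib

section
/- Let E be a real inner product space, let n ≥ 2, and let Q₁, …, Qₙ ∈ E with uniform aggregate Q^g = (1/n)·Σ_{v=1}^{n} Q_v and remaining-client aggregate Q_r = (1/(n−1))·Σ_{v≠u} Q_v for a fixed index u. If L : E → ℝ is differentiable and its gradient ∇L is Lipschitz continuous with constant C ≥ 0, then ‖∇L(Q^g) − ∇L(Q_r)‖ ≤ (C/n) · ‖Q_u − Q_r‖. (Hence as n → ∞ the gradient of the global model is determined by the non-local models, witnessing the loss of client u's local information under aggregation.) -/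
/-- The mean of `n ≥ 2` vectors minus the mean of all but the `u`-th one is `1 / n` times
the deviation of the `u`-th vector from the latter. -/
theorem mean_sub_mean_erase {E : Type*} [AddCommGroup E] [Module ℝ E] {n : ℕ} (hn : 2 ≤ n)
    (Q : Fin n → E) (u : Fin n) :
    (1 / (n : ℝ)) • ∑ v, Q v - ((n : ℝ) - 1)⁻¹ • ∑ v ∈ Finset.univ.erase u, Q v =
      (1 / (n : ℝ)) • (Q u - ((n : ℝ) - 1)⁻¹ • ∑ v ∈ Finset.univ.erase u, Q v) := by
  have hn' : (2 : ℝ) ≤ n := by exact_mod_cast hn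
  have h0 : (n : ℝ) ≠ 0 := by linarith
  have h1 : (n : ℝ) - 1 ≠ 0 := by linarith
  rw [← Finset.add_sum_erase _ Q (Finset.mem_univ u)]
  match_scalars <;> field_simp <;> ring

/-- With a `C`-Lipschitz gradient, the gradient at the uniformly aggregated
global model differs from the gradient at the remaining-client aggregate by at
most `(C/n) * ‖Q u - Q_r‖`. -/
theorem gradient_global_close_to_remaining
    {E : Type*} [NormedAddCommGroup E] [InnerProductSpace ℝ E] [CompleteSpace E]
    (L : E → ℝ) (gradL : E → E)
    (hdiff : ∀ x, HasGradientAt L (gradL x) x)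
    (C : ℝ) (hC : 0 ≤ C)
    (hlip : ∀ x y, ‖gradL x - gradL y‖ ≤ C * ‖x - y‖)
    (n : ℕ) (hn : 2 ≤ n) (Q : Fin n → E) (u : Fin n)
    (Qg Qr : E)
    (hQg : Qg = (1 / (n : ℝ)) • ∑ v, Q v)
    (hQr : Qr = ((n : ℝ) - 1)⁻¹ • ∑ v ∈ Finset.univ.erase u, Q v) :
    ‖gradL Qg - gradL Qr‖ ≤ (C / (n : ℝ)) * ‖Q u - Qr‖ := by
  have hsub : Qg - Qr = (1 / (n : ℝ)) • (Q u - Qr) := by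
    subst hQg hQr
    exact mean_sub_mean_erase hn Q u
  calc ‖gradL Qg - gradL Qr‖ ≤ C * ‖Qg - Qr‖ := hlip Qg Qr
    _ = C / n * ‖Q u - Qr‖ := by
      rw [hsub, norm_smul, Real.norm_of_nonneg (by positivity)]
      ring
end

section
/- (Compensation effect of elastic merging.) Let E be a real inner product space and let L : E → ℝ be differentiable with C₀-Lipschitz gradient ∇L (C₀ ≥ 0). Let Q^l, Q^g, Q* ∈ E, set Δ = Q^g − Q^l, let ρ ∈ [0,1], and define the merged model Q^m = (1−ρ)·Q^l + ρ·Q^g. Define the deviation C = ‖∇L(Q^l)‖·(‖Q^l − Q*‖ + ‖Δ‖) + C₀·‖Δ‖·(‖Q^l − Q*‖ + ρ·‖Δ‖). Then ⟨∇L(Q^m), Q^m − Q*⟩ ≥ (1−ρ)·⟨∇L(Q^l), Q^l − Q*⟩ − ρ·C. -/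
open RealInnerProductSpace

/-- Compensation effect of elastic merging: the merged model
`Qm = (1-ρ)•Ql + ρ•Qg` satisfies
`⟪∇L(Qm), Qm - Q*⟫ ≥ (1-ρ)⟪∇L(Ql), Ql - Q*⟫ - ρ * C`, where `C` is the
deviation introduced by global aggregation. -/
theorem compensation_effect_of_elastic_merging
    {E : Type*} [NormedAddCommGroup E] [InnerProductSpace ℝ E] [CompleteSpace E]
    (L : E → ℝ) (gradL : E → E)
    (hdiff : ∀ x, HasGradientAt L (gradL x) x)
    (C₀ : ℝ) (hC₀ : 0 ≤ C₀)
    (hlip : ∀ x y, ‖gradL x - gradL y‖ ≤ C₀ * ‖x - y‖)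
    (Ql Qg Qstar : E) (Δ : E) (hΔ : Δ = Qg - Ql)
    (ρ : ℝ) (hρ0 : 0 ≤ ρ) (hρ1 : ρ ≤ 1)
    (Qm : E) (hQm : Qm = (1 - ρ) • Ql + ρ • Qg)
    (C : ℝ)
    (hC : C = ‖gradL Ql‖ * (‖Ql - Qstar‖ + ‖Δ‖)
            + C₀ * ‖Δ‖ * (‖Ql - Qstar‖ + ρ * ‖Δ‖)) :
    ⟪gradL Qm, Qm - Qstar⟫ ≥ (1 - ρ) * ⟪gradL Ql, Ql - Qstar⟫ - ρ * C := by
  have hm : Qm - Qstar = (Ql - Qstar) + ρ • Δ := by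
    rw [hQm, hΔ]; module
  have hml : Qm - Ql = ρ • Δ := by
    rw [hQm, hΔ]; module
  have hgrad : ‖gradL Qm - gradL Ql‖ ≤ C₀ * (ρ * ‖Δ‖) := by
    simpa [hml, norm_smul, abs_of_nonneg hρ0] using hlip Qm Ql
  have hnorm : ‖Qm - Qstar‖ ≤ ‖Ql - Qstar‖ + ρ * ‖Δ‖ := by
    rw [hm]
    simpa [norm_smul, abs_of_nonneg hρ0] using norm_add_le (Ql - Qstar) (ρ • Δ)
  have hsplit : ⟪gradL Qm, Qm - Qstar⟫ = ⟪gradL Ql, Ql - Qstar⟫ + ρ * ⟪gradL Ql, Δ⟫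
      + ⟪gradL Qm - gradL Ql, Qm - Qstar⟫ := by
    rw [inner_sub_left, hm, inner_add_right (gradL Ql), real_inner_smul_right (gradL Ql)]
    ring
  have hchange : -(C₀ * (ρ * ‖Δ‖) * (‖Ql - Qstar‖ + ρ * ‖Δ‖))
      ≤ ⟪gradL Qm - gradL Ql, Qm - Qstar⟫ :=
    (abs_le.mp ((abs_real_inner_le_norm _ _).trans
      (mul_le_mul hgrad hnorm (norm_nonneg _) (by positivity)))).1
  have hdev := mul_le_mul_of_nonneg_left
    (abs_le.mp (abs_real_inner_le_norm (gradL Ql) (Ql - Qstar))).1 hρ0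
  have hdir := mul_le_mul_of_nonneg_left
    (abs_le.mp (abs_real_inner_le_norm (gradL Ql) Δ)).1 hρ0
  rw [hsplit, hC]
  linarith
end

section
/- Let E be a real inner product space and let L : E → ℝ be differentiable with C₀-Lipschitz gradient (C₀ ≥ 0). Let Q^l, Q^g, Q* ∈ E, Δ = Q^g − Q^l, ρ ∈ [0,1], Q^m = (1−ρ)·Q^l + ρ·Q^g, and C = ‖∇L(Q^l)‖·(‖Q^l − Q*‖ + ‖Δ‖) + C₀·‖Δ‖·(‖Q^l − Q*‖ + ρ·‖Δ‖). Suppose A = ⟨∇L(Q^l), Q^l − Q*⟩ > 0 and ρ < A/(A+C). Then the merged model remains aligned with the client-specific optimum: ⟨∇L(Q^m), Q^m − Q*⟩ > 0. -/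
open RealInnerProductSpace

/-- If the local alignment `A = ⟪∇L(Ql), Ql - Q*⟫` is positive and the merging
weight satisfies `ρ < A/(A+C)`, then the elastically merged model
`Qm = (1-ρ)•Ql + ρ•Qg` remains aligned with the client-specific optimum:
`⟪∇L(Qm), Qm - Q*⟫ > 0`. -/
theorem merged_model_remains_aligned
    {E : Type*} [NormedAddCommGroup E] [InnerProductSpace ℝ E] [CompleteSpace E]
    (L : E → ℝ) (gradL : E → E)
    (hdiff : ∀ x, HasGradientAt L (gradL x) x)
    (C₀ : ℝ) (hC₀ : 0 ≤ C₀)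
    (hlip : ∀ x y, ‖gradL x - gradL y‖ ≤ C₀ * ‖x - y‖)
    (Ql Qg Qstar : E) (Δ : E) (hΔ : Δ = Qg - Ql)
    (ρ : ℝ) (hρ0 : 0 ≤ ρ) (hρ1 : ρ ≤ 1)
    (Qm : E) (hQm : Qm = (1 - ρ) • Ql + ρ • Qg)
    (C : ℝ)
    (hC : C = ‖gradL Ql‖ * (‖Ql - Qstar‖ + ‖Δ‖)
            + C₀ * ‖Δ‖ * (‖Ql - Qstar‖ + ρ * ‖Δ‖))
    (A : ℝ) (hA : A = ⟪gradL Ql, Ql - Qstar⟫) (hApos : 0 < A)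
    (hρlt : ρ < A / (A + C)) :
    ⟪gradL Qm, Qm - Qstar⟫ > 0 := by
  have hstep : Qm - Ql = ρ • Δ := by rw [hQm, hΔ]; module
  have hsplit : Qm - Qstar = (Ql - Qstar) + ρ • Δ := by rw [← hstep]; abel
  have hdecomp : ⟪gradL Qm, Qm - Qstar⟫
      = A + ρ * ⟪gradL Ql, Δ⟫ + ⟪gradL Qm - gradL Ql, Qm - Qstar⟫ := by
    rw [inner_sub_left, hA, hsplit, inner_add_right (gradL Ql), real_inner_smul_right]
    ring
  have hnorm : ‖ρ • Δ‖ = ρ * ‖Δ‖ := by rw [norm_smul, Real.norm_of_nonneg hρ0]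
  have hgrad : ‖gradL Qm - gradL Ql‖ ≤ C₀ * (ρ * ‖Δ‖) := by
    rw [← hnorm, ← hstep]
    exact hlip Qm Ql
  have hdist : ‖Qm - Qstar‖ ≤ ‖Ql - Qstar‖ + ρ * ‖Δ‖ := by
    rw [hsplit, ← hnorm]
    exact norm_add_le _ _
  have hlin : -(ρ * (‖gradL Ql‖ * ‖Δ‖)) ≤ ρ * ⟪gradL Ql, Δ⟫ := by
    rw [← mul_neg]
    exact mul_le_mul_of_nonneg_left
      (neg_le_of_abs_le (abs_real_inner_le_norm _ _)) hρ0
  have hrem : -(C₀ * (ρ * ‖Δ‖) * (‖Ql - Qstar‖ + ρ * ‖Δ‖))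
      ≤ ⟪gradL Qm - gradL Ql, Qm - Qstar⟫ :=
    neg_le_of_abs_le <| (abs_real_inner_le_norm _ _).trans <|
      mul_le_mul hgrad hdist (norm_nonneg _) (by positivity)
  have hCnonneg : 0 ≤ C := by rw [hC]; positivity
  have hmul : ρ * (A + C) < A := (lt_div_iff₀ (by positivity)).mp hρlt
  have hρC : ρ * C < A := by linarith [mul_nonneg hρ0 hApos.le]
  have hslack : 0 ≤ ρ * (‖gradL Ql‖ * ‖Ql - Qstar‖) := by positivity
  rw [hC] at hρC
  rw [hdecomp]
  linarith
end
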